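/- Diminishing bound for the CADA2 gradient-innovation test quantity (the derivation of equation (10) of the paper, finite-sample form). Assume the convex finite-sum setup. Then for every m ∈ {1, …, M} and all θ, θ' ∈ ℝ^p: (1/n) ∑_{j=1}^n ‖∇ℓ_{m,j}(θ) − ∇ℓ_{m,j}(θ')‖² ≤ 8 M L̄ (L(θ) − L(θ*)) + 12 M L̄ (L(θ') − L(θ*)). -/

import Mathlib

open scoped RealInnerProductSpace BigOperators

noncomputable section

section Smooth

variable {E : Type*} [NormedAddCommGroup E] [InnerProductSpace ℝ E] [CompleteSpace E]

theorem HasGradientAt.hasDerivAt_comp_line {f : E → ℝ} {g x v : E} {t : ℝ}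
    (h : HasGradientAt f g (x + t • v)) :
    HasDerivAt (fun s : ℝ => f (x + s • v)) ⟪g, v⟫ t := by
  have hline : HasDerivAt (fun s : ℝ => x + s • v) v t := by
    simpa using ((hasDerivAt_id t).smul_const v).const_add x
  exact (h.hasFDerivAt.comp_hasDerivAt t hline).congr_deriv (by simp)

/-- First-order characterization of convexity. -/
theorem ConvexOn.add_inner_le_of_hasGradientAt {f : E → ℝ} {g x : E}
    (hf : ConvexOn ℝ Set.univ f) (h : HasGradientAt f g x) (y : E) :
    f x + ⟪g, y - x⟫ ≤ f y := by
  have hd : HasDerivAt (fun s : ℝ => f (x + s • (y - x))) ⟪g, y - x⟫ 0 :=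
    HasGradientAt.hasDerivAt_comp_line (by simpa using h)
  have hc : ConvexOn ℝ Set.univ (fun s : ℝ => f (x + s • (y - x))) := by
    have := hf.comp_affineMap (AffineMap.lineMap x y : ℝ →ᵃ[ℝ] E)
    simpa [Function.comp_def, AffineMap.lineMap_apply, add_comm] using this
  have := hc.le_slope_of_hasDerivAt (Set.mem_univ 0) (Set.mem_univ 1) one_pos hd
  simp [slope_def_field] at this
  linarith

/-- The descent lemma for functions with Lipschitz gradient. -/
theorem le_add_inner_add_of_lipschitzWith_gradient {f : E → ℝ} {g : E → E} {K : NNReal}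
    (h : ∀ x, HasGradientAt f (g x) x) (hg : LipschitzWith K g) (x y : E) :
    f y ≤ f x + ⟪g x, y - x⟫ + K / 2 * ‖y - x‖ ^ 2 := by
  set v := y - x with hv
  let ψ : ℝ → ℝ := fun t => f (x + t • v) - (t * ⟪g x, v⟫ + t ^ 2 * (K / 2 * ‖v‖ ^ 2))
  have hd (t : ℝ) : HasDerivAt ψ (⟪g (x + t • v), v⟫ - (⟪g x, v⟫ + t * (K * ‖v‖ ^ 2))) t := by
    have h₁ := (h (x + t • v)).hasDerivAt_comp_line
    have h₂ := ((hasDerivAt_id t).mul_const ⟪g x, v⟫).add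
      ((hasDerivAt_pow 2 t).mul_const (K / 2 * ‖v‖ ^ 2))
    refine (h₁.sub h₂).congr_deriv ?_
    push_cast
    ring
  have hanti : AntitoneOn ψ (Set.Icc 0 1) := by
    refine antitoneOn_of_deriv_nonpos (convex_Icc 0 1)
      (fun t _ => (hd t).continuousAt.continuousWithinAt)
      (fun t _ => (hd t).differentiableAt.differentiableWithinAt) fun t ht => ?_
    rw [interior_Icc] at ht
    rw [(hd t).deriv]
    have h₁ : ‖g (x + t • v) - g x‖ ≤ K * (t * ‖v‖) := by
      simpa [norm_smul, abs_of_pos ht.1] using hg.norm_sub_le (x + t • v) x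
    have h₂ := real_inner_le_norm (g (x + t • v) - g x) v
    rw [inner_sub_left] at h₂
    nlinarith [mul_le_mul_of_nonneg_right h₁ (norm_nonneg v)]
  have := hanti (Set.left_mem_Icc.2 zero_le_one) (Set.right_mem_Icc.2 zero_le_one) zero_le_one
  simp [ψ, hv] at this
  linarith

/-- For a convex function with `K`-Lipschitz gradient, the squared gradient difference is controlled
by the Bregman divergence. -/
theorem ConvexOn.norm_gradient_sub_sq_le {f : E → ℝ} {g : E → E} {K : NNReal} (hK : 0 < K)
    (hf : ConvexOn ℝ Set.univ f) (h : ∀ x, HasGradientAt f (g x) x) (hg : LipschitzWith K g)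
    (x y : E) : ‖g y - g x‖ ^ 2 ≤ 2 * K * (f y - f x - ⟪g x, y - x⟫) := by
  have hK' : (0 : ℝ) < K := hK
  set d := g y - g x with hd
  have hlow := hf.add_inner_le_of_hasGradientAt (h x) (y - (K : ℝ)⁻¹ • d)
  have hupp := le_add_inner_add_of_lipschitzWith_gradient h hg y (y - (K : ℝ)⁻¹ • d)
  have hdd : ⟪g y, d⟫ - ⟪g x, d⟫ = ‖d‖ ^ 2 := by
    rw [← inner_sub_left, ← hd, real_inner_self_eq_norm_sq]
  rw [sub_right_comm, inner_sub_right, real_inner_smul_right] at hlow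
  rw [sub_sub_cancel_left, inner_neg_right, real_inner_smul_right, norm_neg, norm_smul,
    Real.norm_of_nonneg (by positivity)] at hupp
  have key : ‖d‖ ^ 2 * (K : ℝ)⁻¹ ≤
      f y - f x - ⟪g x, y - x⟫ + (K : ℝ) / 2 * ((K : ℝ)⁻¹ * ‖d‖) ^ 2 := by
    rw [← hdd, sub_mul]
    linarith
  field_simp at key
  linarith

end Smooth

/-- Diminishing bound for the CADA2 gradient-innovation test quantity
(derivation of equation (10) of the paper, finite-sample form). -/
theorem cada2_innovation_bound
    (p n M : ℕ) (hp : 1 ≤ p) (hn : 1 ≤ n) (hM : 1 ≤ M) (Lbar : ℝ) (hLbar : 0 < Lbar)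
    (ℓ : Fin M → Fin n → EuclideanSpace ℝ (Fin p) → ℝ)
    (gℓ : Fin M → Fin n → EuclideanSpace ℝ (Fin p) → EuclideanSpace ℝ (Fin p))
    (hconv : ∀ m j, ConvexOn ℝ Set.univ (ℓ m j))
    (hgrad : ∀ m j x, HasGradientAt (ℓ m j) (gℓ m j x) x)
    (hlip : ∀ m j, LipschitzWith Lbar.toNNReal (gℓ m j))
    (Lm : Fin M → EuclideanSpace ℝ (Fin p) → ℝ)
    (hLm : ∀ m x, Lm m x = (n : ℝ)⁻¹ * ∑ j, ℓ m j x)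
    (gLm : Fin M → EuclideanSpace ℝ (Fin p) → EuclideanSpace ℝ (Fin p))
    (hgLm : ∀ m x, HasGradientAt (Lm m) (gLm m x) x)
    (L : EuclideanSpace ℝ (Fin p) → ℝ)
    (hL : ∀ x, L x = (M : ℝ)⁻¹ * ∑ m, Lm m x)
    (θstar : EuclideanSpace ℝ (Fin p))
    (hmin : ∀ x, L θstar ≤ L x)
    :
    ∀ (m : Fin M) (θ θ' : EuclideanSpace ℝ (Fin p)),
      (n : ℝ)⁻¹ * ∑ j, ‖gℓ m j θ - gℓ m j θ'‖ ^ 2 ≤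
        8 * M * Lbar * (L θ - L θstar) + 12 * M * Lbar * (L θ' - L θstar) := by
  intro m θ θ'
  have hM0 : (0 : ℝ) < M := by exact_mod_cast hM
  have hn0 : (0 : ℝ) < n := by exact_mod_cast hn
  have hLsum (x) : ∑ i, ∑ j, ℓ i j x = M * n * L x := by
    simp only [hL, hLm, ← Finset.mul_sum]
    field_simp
  have hstat (v) : ∑ i, ∑ j, ⟪gℓ i j θstar, v⟫ = 0 := by
    have h₁ : HasDerivAt (fun s : ℝ => ∑ i, ∑ j, ℓ i j (θstar + s • v))
        (∑ i, ∑ j, ⟪gℓ i j θstar, v⟫) 0 :=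
      HasDerivAt.fun_sum fun i _ => HasDerivAt.fun_sum fun j _ =>
        HasGradientAt.hasDerivAt_comp_line (by simpa using hgrad i j θstar)
    refine IsLocalMin.hasDerivAt_eq_zero (Filter.Eventually.of_forall fun s => ?_) h₁
    simp only [hLsum, zero_smul, add_zero]
    exact mul_le_mul_of_nonneg_left (hmin _) (by positivity)
  have hstar (x) : ∑ j, ‖gℓ m j x - gℓ m j θstar‖ ^ 2 ≤
      2 * Lbar * (M * n * (L x - L θstar)) :=
    calc
      _ ≤ ∑ i, ∑ j, ‖gℓ i j x - gℓ i j θstar‖ ^ 2 :=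
        Finset.single_le_sum (f := fun i => ∑ j, ‖gℓ i j x - gℓ i j θstar‖ ^ 2)
          (fun i _ => by positivity) (Finset.mem_univ m)
      _ ≤ ∑ i, ∑ j, 2 * Lbar * (ℓ i j x - ℓ i j θstar - ⟪gℓ i j θstar, x - θstar⟫) := by
        gcongr with i _ j _
        simpa [Real.coe_toNNReal _ hLbar.le] using (hconv i j).norm_gradient_sub_sq_le
          (Real.toNNReal_pos.2 hLbar) (hgrad i j) (hlip i j) θstar x
      _ = _ := by
        simp only [← Finset.mul_sum, Finset.sum_sub_distrib, hLsum, hstat]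
        ring
  have htri : ∑ j, ‖gℓ m j θ - gℓ m j θ'‖ ^ 2 ≤
      2 * ∑ j, ‖gℓ m j θ - gℓ m j θstar‖ ^ 2 + 2 * ∑ j, ‖gℓ m j θ' - gℓ m j θstar‖ ^ 2 := by
    rw [Finset.mul_sum, Finset.mul_sum, ← Finset.sum_add_distrib]
    gcongr with j
    have h₁ := norm_sub_le (gℓ m j θ - gℓ m j θstar) (gℓ m j θ' - gℓ m j θstar)
    rw [sub_sub_sub_cancel_right] at h₁
    have h₂ := pow_le_pow_left₀ (norm_nonneg _) h₁ 2
    linarith [add_sq_le (a := ‖gℓ m j θ - gℓ m j θstar‖) (b := ‖gℓ m j θ' - gℓ m j θstar‖)]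
  have hθ : 0 ≤ M * Lbar * (L θ - L θstar) :=
    mul_nonneg (by positivity) (sub_nonneg.2 (hmin θ))
  have hθ' : 0 ≤ M * Lbar * (L θ' - L θstar) :=
    mul_nonneg (by positivity) (sub_nonneg.2 (hmin θ'))
  rw [inv_mul_le_iff₀ hn0]
  calc
    _ ≤ n * (4 * (M * Lbar * (L θ - L θstar)) + 4 * (M * Lbar * (L θ' - L θstar))) := by
      linarith [hstar θ, hstar θ']
    _ ≤ _ := mul_le_mul_of_nonneg_left (by linarith) hn0.le
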